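/- arXiv:1312.7864 — 6 statements merged into one kernel-verified Lean document; each statement's English description precedes it below -/
import Mathlib

section
/- Let E be a real normed vector space, D ⊆ E a compact convex set, and f : E → ℝ a function differentiable on D with Fréchet derivative f'. Assume f is μ-strongly convex on D with constant μ > 0, i.e. f(y) ≥ f(x) + f'(x)(y − x) + (μ/2)·‖y − x‖² for all x, y ∈ D. Let x* ∈ D and δ > 0 be such that ‖s − x*‖ ≥ δ for every s in the topological frontier of D. Then for every x ∈ D with x ≠ x*, every s̄ in the frontier of D such that x* lies on the segment from x to s̄ (i.e. x* = x + t(s̄ − x) for some t ∈ [0,1]), and every γ ∈ (0,1], the point y = x + γ(s̄ − x) satisfies f(y) − f(x) − f'(x)(y − x) ≥ (γ²/2)·μ·δ². (In particular the affine-invariant 'interior' strong convexity constant μ_f^FW satisfies μ_f^FW ≥ μ·δ².) -/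
open Set

/-- Interpretation of the affine-invariant "interior" strong convexity
constant: if `f` is `μ`-strongly convex on a compact convex set `D` and every boundary
point of `D` is at distance at least `δ` from `x*`, then along any ray from a point
`x ∈ D` through `x*` to a boundary point `s̄`, the Bregman divergence is lower bounded by
`(γ²/2)·μ·δ²`. -/
theorem frankWolfe_interior_strong_convexity_lower_bound
    {E : Type*} [NormedAddCommGroup E] [NormedSpace ℝ E]
    (D : Set E) (hDcompact : IsCompact D) (hDconv : Convex ℝ D)
    (f : E → ℝ) (f' : E → (E →L[ℝ] ℝ))
    (hdiff : ∀ x ∈ D, HasFDerivWithinAt f (f' x) D x)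
    (μ : ℝ) (hμ : 0 < μ)
    (hstrong : ∀ x ∈ D, ∀ y ∈ D,
      f x + f' x (y - x) + μ / 2 * ‖y - x‖ ^ 2 ≤ f y)
    (xstar : E) (hxstar : xstar ∈ D)
    (δ : ℝ) (hδ : 0 < δ)
    (hfar : ∀ s ∈ frontier D, δ ≤ ‖s - xstar‖) :
    ∀ x ∈ D, x ≠ xstar →
      ∀ sbar ∈ frontier D,
        (∃ t ∈ Icc (0 : ℝ) 1, xstar = x + t • (sbar - x)) →
          ∀ γ ∈ Ioc (0 : ℝ) 1,
            f (x + γ • (sbar - x)) - f x - f' x ((x + γ • (sbar - x)) - x)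
              ≥ γ ^ 2 / 2 * μ * δ ^ 2 := by
  rintro x hx - s hs ⟨t, ⟨ht0, ht1⟩, ht⟩ γ ⟨hγ0, hγ1⟩
  have hsD : s ∈ D := hDcompact.isClosed.frontier_subset hs
  have hy : x + γ • (s - x) ∈ D := hDconv.add_smul_sub_mem hx hsD ⟨hγ0.le, hγ1⟩
  have hδs : δ ≤ ‖s - x‖ :=
    calc δ ≤ ‖s - xstar‖ := hfar s hs
      _ = ‖(1 - t) • (s - x)‖ := by rw [ht]; congr 1; module
      _ = (1 - t) * ‖s - x‖ := by rw [norm_smul, Real.norm_of_nonneg (by linarith)]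
      _ ≤ ‖s - x‖ := mul_le_of_le_one_left (norm_nonneg _) (by linarith)
  have hnorm : ‖x + γ • (s - x) - x‖ = γ * ‖s - x‖ := by
    rw [add_sub_cancel_left, norm_smul, Real.norm_of_nonneg hγ0.le]
  have hbregman := hstrong x hx _ hy
  rw [hnorm] at hbregman
  have hbound : γ ^ 2 / 2 * μ * δ ^ 2 ≤ γ ^ 2 / 2 * μ * ‖s - x‖ ^ 2 := by gcongr
  linarith
end

section
/- Let E be a real normed vector space, D ⊆ E a compact convex set, f : E → ℝ convex and differentiable on D with Fréchet derivative f', and let x* ∈ D be a minimizer of f over D. Assume there is a curvature constant C > 0 such that f(x + γ(s − x)) ≤ f(x) + γ·f'(x)(s − x) + (γ²/2)·C for all x, s ∈ D and γ ∈ [0,1]. Assume there is μ > 0 such that for every x ∈ D with x ≠ x* there exist s̄ ∈ D and γ̄ ∈ (0,1] with x* = x + γ̄(s̄ − x) and f(x*) − f(x) − γ̄·f'(x)(s̄ − x) ≥ (γ̄²/2)·μ. For x ∈ D define the duality gap g(x) = sup_{s ∈ D} f'(x)(x − s). Let x ∈ D, let s ∈ D satisfy f'(x)(s) ≤ f'(x)(s')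 for all s' ∈ D, set γ = min{1, g(x)/C} and x' = x + γ(s − x). Then f(x') − f(x*) ≤ (1 − min{1/2, μ/C})·(f(x) − f(x*)). -/
open Set

/-- Per-iteration linear convergence of the standard Frank-Wolfe
algorithm (exact oracle, step-size `γ = min{1, g(x)/C}`) under the affine-invariant
curvature bound `C` and the "interior" strong convexity bound `μ`. -/
theorem frankWolfe_linear_convergence_step
    {E : Type*} [NormedAddCommGroup E] [NormedSpace ℝ E]
    (D : Set E) (hDcompact : IsCompact D) (hDconv : Convex ℝ D)
    (f : E → ℝ) (f' : E → (E →L[ℝ] ℝ))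
    (hconv : ConvexOn ℝ D f)
    (hdiff : ∀ x ∈ D, HasFDerivWithinAt f (f' x) D x)
    (xstar : E) (hxstar : xstar ∈ D) (hmin : ∀ y ∈ D, f xstar ≤ f y)
    (C : ℝ) (hC : 0 < C)
    (hcurv : ∀ x ∈ D, ∀ s ∈ D, ∀ γ ∈ Icc (0 : ℝ) 1,
      f (x + γ • (s - x)) ≤ f x + γ * f' x (s - x) + γ ^ 2 / 2 * C)
    (μ : ℝ) (hμ : 0 < μ)
    (hstrong : ∀ x ∈ D, x ≠ xstar → ∃ sbar ∈ D, ∃ γbar ∈ Ioc (0 : ℝ) 1,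
      xstar = x + γbar • (sbar - x) ∧
      f xstar - f x - γbar * f' x (sbar - x) ≥ γbar ^ 2 / 2 * μ)
    (x : E) (hx : x ∈ D)
    (s : E) (hs : s ∈ D) (hsmin : ∀ s' ∈ D, f' x s ≤ f' x s')
    (g : ℝ) (hg : g = sSup ((fun s' => f' x (x - s')) '' D))
    (γ : ℝ) (hγ : γ = min 1 (g / C))
    (x' : E) (hx' : x' = x + γ • (s - x)) :
    f x' - f xstar ≤ (1 - min (1 / 2 : ℝ) (μ / C)) * (f x - f xstar) := by
  have hle : ∀ s' ∈ D, f' x (x - s') ≤ f' x (x - s) := fun s' hs' => by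
    simpa only [map_sub] using sub_le_sub_left (hsmin s' hs') (f' x x)
  have hgap : g = f' x (x - s) :=
    hg.trans (IsGreatest.csSup_eq ⟨mem_image_of_mem _ hs, forall_mem_image.2 hle⟩)
  have hg0 : 0 ≤ g := by simpa [hgap] using hle x hx
  have hneg : ∀ y, f' x (y - x) = -f' x (x - y) := fun y => by
    rw [← map_neg, neg_sub]
  have hh0 : 0 ≤ f x - f xstar := sub_nonneg.2 (hmin x hx)
  -- the primal gap is controlled both linearly and quadratically by the duality gap
  obtain ⟨hlin, hquad⟩ : f x - f xstar ≤ g ∧ 2 * μ * (f x - f xstar) ≤ g ^ 2 := by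
    by_cases hxs : x = xstar
    · subst hxs
      simpa using ⟨hg0, sq_nonneg g⟩
    obtain ⟨t, ht, r, ⟨hr0, hr1⟩, -, hr⟩ := hstrong x hx hxs
    have hrt : r * f' x (x - t) ≤ r * g :=
      mul_le_mul_of_nonneg_left (hgap ▸ hle t ht) hr0.le
    rw [hneg] at hr
    have hprimal : f x - f xstar ≤ r * g - r ^ 2 / 2 * μ := by linarith
    constructor
    · have : r * g ≤ g := mul_le_of_le_one_left hg0 hr1
      have : 0 ≤ r ^ 2 / 2 * μ := by positivity
      linarith
    · nlinarith [sq_nonneg (g - r * μ), mul_le_mul_of_nonneg_left hprimal hμ.le]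
  have hγ01 : γ ∈ Icc (0 : ℝ) 1 := by
    rw [hγ]
    exact ⟨le_min zero_le_one (div_nonneg hg0 hC.le), min_le_left _ _⟩
  have hstep := hcurv x hx s hs γ hγ01
  rw [← hx', hneg, ← hgap] at hstep
  rcases le_total C g with hCg | hgC
  · have hγ1 : γ = 1 := by rw [hγ, min_eq_left ((one_le_div hC).2 hCg)]
    rw [hγ1] at hstep
    have := mul_le_mul_of_nonneg_right (min_le_left (1 / 2 : ℝ) (μ / C)) hh0
    linarith
  · have hγ1 : γ = g / C := by rw [hγ, min_eq_right ((div_le_one hC).2 hgC)]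
    have hdecr : γ * -g + γ ^ 2 / 2 * C = -(g ^ 2 / (2 * C)) := by
      rw [hγ1]
      field_simp
      ring
    have hrate : μ / C * (f x - f xstar) ≤ g ^ 2 / (2 * C) := by
      rw [le_div_iff₀ (by positivity)]
      calc μ / C * (f x - f xstar) * (2 * C) = 2 * μ * (f x - f xstar) := by
            field_simp
        _ ≤ g ^ 2 := hquad
    have := mul_le_mul_of_nonneg_right (min_le_right (1 / 2 : ℝ) (μ / C)) hh0
    linarith
end

section
/- Let E be a real normed vector space, D ⊆ E a compact convex set, f : E → ℝ convex and differentiable on D with Fréchet derivative f', and let x* ∈ D be a minimizer of f over D. Assume the curvature hypothesis with constant C > 0: f(x + γ(s − x)) ≤ f(x) + γ·f'(x)(s − x) + (γ²/2)·C for all x, s ∈ D, γ ∈ [0,1]. Assume the interior strong convexity hypothesis with constant μ > 0: for every x ∈ D \ {x*} there exist s̄ ∈ D and γ̄ ∈ (0,1] with x* = x + γ̄(s̄ − x) and f(x*) − f(x) − γ̄·f'(x)(s̄ − x) ≥ (γ̄²/2)·μ. Let ν ∈ (0,1], let x ∈ D, and let s ∈ D be a ν-approximate linear oracle answer, i.e.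 f'(x)(x − s) ≥ ν·g(x), where g(x) = sup_{s' ∈ D} f'(x)(x − s'). Set γ = min{1, ν·g(x)/C} and x' = x + γ(s − x). Then f(x') − f(x*) ≤ (1 − min{ν/2, ν²·μ/C})·(f(x) − f(x*)). -/
open Set

/-- Per-iteration linear convergence of the standard Frank-Wolfe
algorithm with a `ν`-approximate (multiplicative accuracy) linear oracle and step-size
`γ = min{1, ν·g(x)/C}`, under the curvature bound `C` and the "interior" strong
convexity bound `μ`. -/
theorem frankWolfe_linear_convergence_step_approx_oracle
    {E : Type*} [NormedAddCommGroup E] [NormedSpace ℝ E]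
    (D : Set E) (hDcompact : IsCompact D) (hDconv : Convex ℝ D)
    (f : E → ℝ) (f' : E → (E →L[ℝ] ℝ))
    (hconv : ConvexOn ℝ D f)
    (hdiff : ∀ x ∈ D, HasFDerivWithinAt f (f' x) D x)
    (xstar : E) (hxstar : xstar ∈ D) (hmin : ∀ y ∈ D, f xstar ≤ f y)
    (C : ℝ) (hC : 0 < C)
    (hcurv : ∀ x ∈ D, ∀ s ∈ D, ∀ γ ∈ Icc (0 : ℝ) 1,
      f (x + γ • (s - x)) ≤ f x + γ * f' x (s - x) + γ ^ 2 / 2 * C)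
    (μ : ℝ) (hμ : 0 < μ)
    (hstrong : ∀ x ∈ D, x ≠ xstar → ∃ sbar ∈ D, ∃ γbar ∈ Ioc (0 : ℝ) 1,
      xstar = x + γbar • (sbar - x) ∧
      f xstar - f x - γbar * f' x (sbar - x) ≥ γbar ^ 2 / 2 * μ)
    (ν : ℝ) (hν : ν ∈ Ioc (0 : ℝ) 1)
    (x : E) (hx : x ∈ D)
    (g : ℝ) (hg : g = sSup ((fun s' => f' x (x - s')) '' D))
    (s : E) (hs : s ∈ D) (hsoracle : f' x (x - s) ≥ ν * g)
    (γ : ℝ) (hγ : γ = min 1 (ν * g / C))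
    (x' : E) (hx' : x' = x + γ • (s - x)) :
    f x' - f xstar ≤ (1 - min (ν / 2) (ν ^ 2 * μ / C)) * (f x - f xstar) := by
  obtain ⟨hν0, hν1⟩ := hν
  have hbdd : BddAbove ((fun s' => f' x (x - s')) '' D) :=
    (hDcompact.image (by fun_prop)).bddAbove
  have hle : ∀ y ∈ D, f' x (x - y) ≤ g := fun y hy =>
    hg ▸ le_csSup hbdd (mem_image_of_mem _ hy)
  have hg0 : 0 ≤ g := by simpa using hle x hx
  have hneg : ∀ y, f' x (y - x) = -f' x (x - y) := fun y => by
    rw [← map_neg, neg_sub]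
  have hνg : 0 ≤ ν * g := by positivity
  have hh0 : 0 ≤ f x - f xstar := sub_nonneg.2 (hmin x hx)
  have hγ0 : 0 ≤ γ := hγ ▸ le_min zero_le_one (by positivity)
  have hγ1 : γ ≤ 1 := hγ ▸ min_le_left _ _
  -- Strong convexity bounds the primal error by the gap, linearly and quadratically.
  have hgap : f x - f xstar ≤ g ∧ 2 * μ * (f x - f xstar) ≤ g ^ 2 := by
    by_cases hxs : x = xstar
    · subst hxs
      simpa using ⟨hg0, sq_nonneg g⟩
    obtain ⟨sbar, hsbar, γbar, ⟨hγb0, hγb1⟩, -, hst⟩ := hstrong x hx hxs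
    rw [hneg] at hst
    have h1 : γbar * f' x (x - sbar) ≤ γbar * g :=
      mul_le_mul_of_nonneg_left (hle sbar hsbar) hγb0.le
    have h2 : f x - f xstar ≤ γbar * g - γbar ^ 2 / 2 * μ := by linarith
    have h3 : γbar * g ≤ g := mul_le_of_le_one_left hg0 hγb1
    have h4 : 0 ≤ γbar ^ 2 / 2 * μ := by positivity
    refine ⟨by linarith, ?_⟩
    have h5 := mul_le_mul_of_nonneg_left h2 (by positivity : 0 ≤ 2 * μ)
    nlinarith [sq_nonneg (g - γbar * μ)]
  have hstep : f x' ≤ f x - γ * (ν * g) + γ ^ 2 / 2 * C := by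
    have h1 := hcurv x hx s hs γ ⟨hγ0, hγ1⟩
    rw [hneg, ← hx'] at h1
    have h2 := mul_le_mul_of_nonneg_left hsoracle hγ0
    linarith
  suffices h : min (ν / 2) (ν ^ 2 * μ / C) * (f x - f xstar) ≤ f x - f x' by linarith
  rcases le_total C (ν * g) with hc | hc
  · have hγ' : γ = 1 := by rw [hγ, min_eq_left ((one_le_div hC).2 hc)]
    rw [hγ'] at hstep
    have h1 := mul_le_mul_of_nonneg_left hgap.1 hν0.le
    have h2 := mul_le_mul_of_nonneg_right (min_le_left (ν / 2) (ν ^ 2 * μ / C)) hh0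
    linarith
  · have hγ' : γ = ν * g / C := by rw [hγ, min_eq_right ((div_le_one hC).2 hc)]
    have h1 : γ * (ν * g) - γ ^ 2 / 2 * C = ν ^ 2 / (2 * C) * g ^ 2 := by
      rw [hγ']; field_simp; ring
    have h2 := mul_le_mul_of_nonneg_left hgap.2 (by positivity : 0 ≤ ν ^ 2 / (2 * C))
    have h3 : ν ^ 2 / (2 * C) * (2 * μ * (f x - f xstar))
        = ν ^ 2 * μ / C * (f x - f xstar) := by
      field_simp
    have h4 := mul_le_mul_of_nonneg_right (min_le_right (ν / 2) (ν ^ 2 * μ / C)) hh0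
    linarith
end

section
/- Let E be a real normed vector space, D ⊆ E a convex set, f : E → ℝ differentiable on D with Fréchet derivative f', x* ∈ D, and μ > 0. Let x ∈ D and suppose there exist s̄ ∈ D and γ̄ ∈ (0,1] with x* = x + γ̄(s̄ − x) and f(x*) − f(x) − γ̄·f'(x)(s̄ − x) ≥ (γ̄²/2)·μ. Let g ∈ ℝ be any number with g ≥ f'(x)(x − s) for all s ∈ D. Then f(x) − f(x*) ≤ g²/(2μ). -/
open Set

/-- The "interior" strong-convexity lower bound applied at the optimum
yields the primal suboptimality bound `f(x) − f(x*) ≤ g²/(2μ)`, where `g` is any upper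
bound on the linearized gaps `f'(x)(x − s)`, `s ∈ D`. -/
theorem primal_suboptimality_le_gap_sq_div_strong_convexity
    {E : Type*} [NormedAddCommGroup E] [NormedSpace ℝ E]
    (D : Set E) (hDconv : Convex ℝ D)
    (f : E → ℝ) (f' : E → (E →L[ℝ] ℝ))
    (hdiff : ∀ y ∈ D, HasFDerivWithinAt f (f' y) D y)
    (xstar : E) (hxstar : xstar ∈ D)
    (μ : ℝ) (hμ : 0 < μ)
    (x : E) (hx : x ∈ D)
    (hstrong : ∃ sbar ∈ D, ∃ γbar ∈ Ioc (0 : ℝ) 1,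
      xstar = x + γbar • (sbar - x) ∧
      f xstar - f x - γbar * f' x (sbar - x) ≥ γbar ^ 2 / 2 * μ)
    (g : ℝ) (hg : ∀ s ∈ D, f' x (x - s) ≤ g) :
    f x - f xstar ≤ g ^ 2 / (2 * μ) := by
  obtain ⟨s, hs, γ, ⟨hγ, -⟩, -, h⟩ := hstrong
  have hgap : -f' x (s - x) ≤ g := by
    rw [← map_neg, neg_sub]
    exact hg s hs
  rw [le_div_iff₀ (by positivity)]
  have hlin : f x - f xstar ≤ γ * g - γ ^ 2 / 2 * μ := by
    linarith [mul_le_mul_of_nonneg_left hgap hγ.le]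
  calc (f x - f xstar) * (2 * μ) ≤ (γ * g - γ ^ 2 / 2 * μ) * (2 * μ) := by gcongr
    _ ≤ g ^ 2 := by linarith [sq_nonneg (g - γ * μ)]
end

section
/- Let E be a real normed vector space, D ⊆ E a compact convex set, f : E → ℝ convex and differentiable on D with Fréchet derivative f', and x* ∈ D a minimizer of f over D. Assume the curvature hypothesis with constant C > 0: f(x + γ(s − x)) ≤ f(x) + γ·f'(x)(s − x) + (γ²/2)·C for all x, s ∈ D, γ ∈ [0,1]. Let ν ∈ (0,1], x ∈ D, and s ∈ D with f'(x)(x − s) ≥ ν·g(x), where g(x) = sup_{s' ∈ D} f'(x)(x − s'). If ν·g(x) > C, then the full step x' = s satisfies f(x') − f(x*) ≤ (1 − ν/2)·(f(x) − f(x*)). -/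
open Set

/-- First-order condition for a convex function differentiable within its domain. -/
theorem ConvexOn.add_apply_sub_le_of_hasFDerivWithinAt
    {E : Type*} [NormedAddCommGroup E] [NormedSpace ℝ E] {D : Set E} {f : E → ℝ}
    {f' : E →L[ℝ] ℝ} {x y : E} (hf : ConvexOn ℝ D f) (hx : x ∈ D) (hy : y ∈ D)
    (hf' : HasFDerivWithinAt f f' D x) : f x + f' (y - x) ≤ f y := by
  have hmaps : MapsTo (AffineMap.lineMap x y : ℝ → E) (Icc 0 1) D :=
    fun t ht => hf.1.lineMap_mem hx hy ht
  have hline : ConvexOn ℝ (Icc (0 : ℝ) 1) (f ∘ AffineMap.lineMap (k := ℝ) x y) :=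
    (hf.comp_affineMap (AffineMap.lineMap (k := ℝ) x y)).subset hmaps (convex_Icc 0 1)
  have hderiv : HasDerivWithinAt (f ∘ AffineMap.lineMap (k := ℝ) x y) (f' (y - x))
      (Icc 0 1) 0 := by
    refine HasFDerivWithinAt.comp_hasDerivWithinAt (t := D) 0 ?_
      AffineMap.hasDerivWithinAt_lineMap hmaps
    simpa using hf'
  have hslope := hline.le_slope_of_hasDerivWithinAt (by simp) (by simp) zero_lt_one hderiv
  simp only [slope_def_field, Function.comp_apply, AffineMap.lineMap_apply_one,
    AffineMap.lineMap_apply_zero, sub_zero, div_one] at hslope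
  linarith

/-- Border case of the Frank-Wolfe convergence analysis: if the
(approximate) duality gap exceeds the curvature constant, `ν·g(x) > C`, then the
full step `x' = s` decreases the primal error by at least the factor `1 − ν/2`. -/
theorem frankWolfe_border_case_full_step
    {E : Type*} [NormedAddCommGroup E] [NormedSpace ℝ E]
    (D : Set E) (hDcompact : IsCompact D) (hDconv : Convex ℝ D)
    (f : E → ℝ) (f' : E → (E →L[ℝ] ℝ))
    (hconv : ConvexOn ℝ D f)
    (hdiff : ∀ x ∈ D, HasFDerivWithinAt f (f' x) D x)
    (xstar : E) (hxstar : xstar ∈ D) (hmin : ∀ y ∈ D, f xstar ≤ f y)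
    (C : ℝ) (hC : 0 < C)
    (hcurv : ∀ x ∈ D, ∀ s ∈ D, ∀ γ ∈ Icc (0 : ℝ) 1,
      f (x + γ • (s - x)) ≤ f x + γ * f' x (s - x) + γ ^ 2 / 2 * C)
    (ν : ℝ) (hν : ν ∈ Ioc (0 : ℝ) 1)
    (x : E) (hx : x ∈ D)
    (g : ℝ) (hg : g = sSup ((fun s' => f' x (x - s')) '' D))
    (s : E) (hs : s ∈ D) (hsoracle : f' x (x - s) ≥ ν * g)
    (hborder : ν * g > C)
    (x' : E) (hx' : x' = s) :
    f x' - f xstar ≤ (1 - ν / 2) * (f x - f xstar) := by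
  have hbdd : BddAbove ((fun s' => f' x (x - s')) '' D) :=
    (hDcompact.image (by fun_prop)).bddAbove
  have hgap : f' x (x - xstar) ≤ g := hg ▸ le_csSup hbdd (mem_image_of_mem _ hxstar)
  have hfirst := hconv.add_apply_sub_le_of_hasFDerivWithinAt hx hxstar (hdiff x hx)
  have hstep := hcurv x hx s hs 1 (by simp)
  rw [one_smul, add_sub_cancel] at hstep
  rw [map_sub] at hgap hfirst hstep hsoracle
  have hprimal : ν * (f x - f xstar) ≤ ν * g :=
    mul_le_mul_of_nonneg_left (by linarith) hν.1.le
  rw [hx']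
  linarith
end

section
/- Let E be a real normed vector space, D ⊆ E a bounded convex set with diameter diam(D) = sup{‖u − w‖ : u, w ∈ D}, and f : E → ℝ differentiable with Fréchet derivative f'. Assume f' is L-Lipschitz on the enlarged set D^A = {x + γ(x − s) : x, s ∈ D, γ ∈ [0,1]} (equivalently on D + (D − D)), i.e. ‖f'(y) − f'(x)‖ ≤ L‖y − x‖ for x, y ∈ D^A. Then for all x, s ∈ D and γ ∈ [0,1], the point y = x + γ(x − s) satisfies f(y) − f(x) − f'(x)(y − x) ≤ (γ²/2)·L·diam(D)². (Hence the away curvature constant satisfies C_f^− ≤ diam(D)²·L.) -/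
open Set

/-- The descent lemma along a segment: if `f'` grows at most linearly at rate `L` away from `x` in
direction `v`, then `f` exceeds its linearization at `x` by at most `γ² / 2 * (L * ‖v‖²)`. -/
theorem sub_sub_fderiv_le_of_lipschitz_segment
    {E : Type*} [NormedAddCommGroup E] [NormedSpace ℝ E] {f : E → ℝ} {f' : E → (E →L[ℝ] ℝ)}
    {x v : E} {L γ : ℝ} (hγ : 0 ≤ γ)
    (hdiff : ∀ t ∈ Icc 0 γ, HasFDerivAt f (f' (x + t • v)) (x + t • v))
    (hLip : ∀ t ∈ Icc 0 γ, ‖f' (x + t • v) - f' x‖ ≤ L * ‖t • v‖) :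
    f (x + γ • v) - f x - f' x (γ • v) ≤ γ ^ 2 / 2 * (L * ‖v‖ ^ 2) := by
  have hderiv : ∀ t ∈ Icc 0 γ, HasDerivAt (fun t : ℝ => f (x + t • v) - f x - t * f' x v)
      (f' (x + t • v) v - f' x v) t := by
    intro t ht
    have hline : HasDerivAt (fun t : ℝ => x + t • v) v t := by
      simpa using ((hasDerivAt_id t).smul_const v).const_add x
    simpa using (((hdiff t ht).comp_hasDerivAt t hline).sub_const (f x)).fun_sub
      ((hasDerivAt_id t).mul_const (f' x v))
  have hquad : ∀ t : ℝ, HasDerivAt (fun t : ℝ => t ^ 2 / 2 * (L * ‖v‖ ^ 2))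
      (t * (L * ‖v‖ ^ 2)) t := by
    intro t
    simpa using (((hasDerivAt_id t).pow 2).div_const 2).mul_const (L * ‖v‖ ^ 2)
  have key := image_le_of_deriv_right_le_deriv_boundary
    (fun t ht => (hderiv t ht).continuousAt.continuousWithinAt)
    (fun t ht => (hderiv t (Ico_subset_Icc_self ht)).hasDerivWithinAt)
    (by simp) (fun t _ => (hquad t).continuousAt.continuousWithinAt)
    (fun t _ => (hquad t).hasDerivWithinAt)
    (fun t ht => by
      calc f' (x + t • v) v - f' x v = (f' (x + t • v) - f' x) v := rfl
        _ ≤ ‖f' (x + t • v) - f' x‖ * ‖v‖ :=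
          (le_abs_self _).trans ((f' (x + t • v) - f' x).le_opNorm v)
        _ ≤ L * ‖t • v‖ * ‖v‖ := by
          gcongr
          exact hLip t (Ico_subset_Icc_self ht)
        _ = t * (L * ‖v‖ ^ 2) := by
          rw [norm_smul, Real.norm_of_nonneg ht.1]
          ring)
    (right_mem_Icc.2 hγ)
  simpa using key

/-- Bound on the away curvature constant: if the derivative of `f` is
`L`-Lipschitz on the enlarged domain `D^A = {x + γ(x − s) : x, s ∈ D, γ ∈ [0,1]}`, then
the normalized Bregman divergence along away directions is bounded by
`(γ²/2)·L·diam(D)²`, i.e. `C_f^− ≤ diam(D)²·L`. -/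
theorem away_curvature_le_diam_sq_mul_lipschitz
    {E : Type*} [NormedAddCommGroup E] [NormedSpace ℝ E]
    (D : Set E) (hDbdd : Bornology.IsBounded D) (hDconv : Convex ℝ D)
    (diamD : ℝ) (hdiam : diamD = sSup {r : ℝ | ∃ u ∈ D, ∃ w ∈ D, r = ‖u - w‖})
    (f : E → ℝ) (f' : E → (E →L[ℝ] ℝ))
    (DA : Set E)
    (hDA : DA = {y | ∃ x ∈ D, ∃ s ∈ D, ∃ γ ∈ Icc (0 : ℝ) 1, y = x + γ • (x - s)})
    (hdiff : ∀ y ∈ DA, HasFDerivAt f (f' y) y)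
    (L : ℝ)
    (hLip : ∀ x ∈ DA, ∀ y ∈ DA, ‖f' y - f' x‖ ≤ L * ‖y - x‖) :
    ∀ x ∈ D, ∀ s ∈ D, ∀ γ ∈ Icc (0 : ℝ) 1,
      f (x + γ • (x - s)) - f x - f' x ((x + γ • (x - s)) - x)
        ≤ γ ^ 2 / 2 * L * diamD ^ 2 := by
  intro x hx s hs γ hγ
  have hmem : ∀ t ∈ Icc (0 : ℝ) γ, x + t • (x - s) ∈ DA := fun t ht =>
    hDA ▸ ⟨x, hx, s, hs, t, ⟨ht.1, ht.2.trans hγ.2⟩, rfl⟩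
  have hDsub : ∀ u ∈ D, u ∈ DA := fun u hu =>
    hDA ▸ ⟨u, hu, u, hu, 0, ⟨le_rfl, zero_le_one⟩, by simp⟩
  have hnorm : ‖x - s‖ ≤ diamD := by
    rw [hdiam]
    refine le_csSup ⟨Metric.diam D, ?_⟩ ⟨x, hx, s, hs, rfl⟩
    rintro _ ⟨u, hu, w, hw, rfl⟩
    exact dist_eq_norm u w ▸ Metric.dist_le_diam_of_mem hDbdd hu hw
  have hdiam_sq : L * ‖x - s‖ ^ 2 ≤ L * diamD ^ 2 := by
    rcases le_or_gt 0 L with hL | hL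
    · gcongr
    · have hdiam_nonpos : diamD ≤ 0 := by
        rw [hdiam]
        refine Real.sSup_le ?_ le_rfl
        rintro _ ⟨u, hu, w, hw, rfl⟩
        have hnonneg := (norm_nonneg _).trans (hLip w (hDsub w hw) u (hDsub u hu))
        exact nonpos_of_mul_nonneg_right hnonneg hL
      rw [le_antisymm (hnorm.trans hdiam_nonpos) (norm_nonneg _),
        le_antisymm hdiam_nonpos ((norm_nonneg _).trans hnorm)]
  have hdescent := sub_sub_fderiv_le_of_lipschitz_segment hγ.1
    (fun t ht => hdiff _ (hmem t ht))
    (fun t ht => by simpa using hLip x (hDsub x hx) _ (hmem t ht))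
  rw [add_sub_cancel_left, mul_assoc]
  exact hdescent.trans (by gcongr)
end
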